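/- arXiv:math/0612580 — 3 statements merged into one kernel-verified Lean document; each statement's English description precedes it below -/
import Mathlib

section
/- Let $\kappa \in \mathbb{R}$ and let $b : \mathbb{N} \to \mathbb{R}$ be a finitely supported sequence. Define, for each $i \in \mathbb{N}$, $a_i = \sum_{n=0}^{\infty} \frac{\kappa^n (i+2n)!}{(4\pi)^n\, n!\, i!}\, b_{i+2n}$ (a finite sum). Then for every $i \in \mathbb{N}$, $b_i = \sum_{n=0}^{\infty} \frac{(-\kappa)^n (i+2n)!}{(4\pi)^n\, n!\, i!}\, a_{i+2n}$. (This is the mutual inversion of the two transforms relating the extended Lipschitz–Killing curvatures $\mathcal{L}_i^\kappa$ to the ordinary ones $\mathcal{L}_i$, equation (5.1) of the paper.) -/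
theorem sum_range_pow_div_factorial_mul {K : Type*} [Field K] [CharZero K] (x y : K) (m : ℕ) :
    ∑ k ∈ Finset.range (m + 1), x ^ k / (k.factorial : K) * (y ^ (m - k) / ((m - k).factorial : K)) =
      (x + y) ^ m / (m.factorial : K) := by
  rw [add_pow, Finset.sum_div]
  refine Finset.sum_congr rfl fun k hk => ?_
  rw [Nat.cast_choose K (Nat.lt_succ_iff.mp (Finset.mem_range.mp hk))]
  have h := Nat.factorial_ne_zero
  have h1 : (m.factorial : K) ≠ 0 := by exact_mod_cast h m
  have h2 : (k.factorial : K) ≠ 0 := by exact_mod_cast h k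
  have h3 : ((m - k).factorial : K) ≠ 0 := by exact_mod_cast h (m - k)
  field_simp

/-- Inversion of the transforms relating the extended
Lipschitz–Killing curvatures `𝓛ᵢ^κ` to the ordinary ones `𝓛ᵢ` (eq. (5.1)). -/
theorem lk_curvature_transform_inversion (κ : ℝ) (b : ℕ → ℝ)
    (hb : (Function.support b).Finite)
    (a : ℕ → ℝ)
    (ha : ∀ i : ℕ, a i = ∑' n : ℕ,
      κ ^ n * (Nat.factorial (i + 2 * n)) /
        ((4 * Real.pi) ^ n * (Nat.factorial n) * (Nat.factorial i)) * b (i + 2 * n)) :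
    ∀ i : ℕ, b i = ∑' n : ℕ,
      (-κ) ^ n * (Nat.factorial (i + 2 * n)) /
        ((4 * Real.pi) ^ n * (Nat.factorial n) * (Nat.factorial i)) * a (i + 2 * n) := by
  intro i
  obtain ⟨N, hN⟩ : ∃ N, ∀ j, N ≤ j → b j = 0 := by
    obtain ⟨M, hM⟩ := hb.bddAbove
    refine ⟨M + 1, fun j hj => ?_⟩
    by_contra h
    have := hM (Function.mem_support.mpr h)
    omega
  have ha_sum (n : ℕ) : a (i + 2 * n) = ∑ m ∈ Finset.range (N + 1 - n),
      κ ^ m * (Nat.factorial (i + 2 * n + 2 * m)) /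
        ((4 * Real.pi) ^ m * (Nat.factorial m) * (Nat.factorial (i + 2 * n))) *
          b (i + 2 * n + 2 * m) := by
    rw [ha]
    refine tsum_eq_sum fun m hm => ?_
    rw [Finset.mem_range] at hm
    rw [hN _ (by omega), mul_zero]
  have hfact (n : ℕ) : (n.factorial : ℝ) ≠ 0 := by exact_mod_cast n.factorial_ne_zero
  have hpi : (4 * Real.pi) ≠ 0 := by positivity
  rw [tsum_eq_sum (s := Finset.range (N + 1))]
  · set F : ℕ → ℕ → ℝ := fun n m =>
      ((-κ / (4 * Real.pi)) ^ n / n.factorial * ((κ / (4 * Real.pi)) ^ m / m.factorial)) *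
        ((i + 2 * (n + m)).factorial / i.factorial * b (i + 2 * (n + m))) with hF
    have hterm (n : ℕ) : (-κ) ^ n * (Nat.factorial (i + 2 * n)) /
        ((4 * Real.pi) ^ n * (Nat.factorial n) * (Nat.factorial i)) * a (i + 2 * n) =
          ∑ m ∈ Finset.range (N + 1 - n), F n m := by
      rw [ha_sum, Finset.mul_sum]
      refine Finset.sum_congr rfl fun m _ => ?_
      have hidx : i + 2 * n + 2 * m = i + 2 * (n + m) := by ring
      rw [hF, hidx]
      have h1 := hfact n
      have h2 := hfact m
      have h3 := hfact i
      have h4 := hfact (i + 2 * n)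
      simp only [div_pow]
      field_simp
    have hdiag (m : ℕ) : ∑ k ∈ Finset.range (m + 1), F k (m - k) =
        0 ^ m / m.factorial * ((i + 2 * m).factorial / i.factorial * b (i + 2 * m)) := by
      have hzero : -κ / (4 * Real.pi) + κ / (4 * Real.pi) = 0 := by ring
      rw [← hzero, ← sum_range_pow_div_factorial_mul, Finset.sum_mul]
      refine Finset.sum_congr rfl fun k hk => ?_
      rw [hF]
      simp only [Nat.add_sub_cancel' (Nat.lt_succ_iff.mp (Finset.mem_range.mp hk))]
    simp_rw [hterm]
    rw [← Finset.sum_range_diag_flip]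
    simp_rw [hdiag]
    rw [Finset.sum_eq_single 0]
    · simp [div_self (hfact i)]
    · intro m _ hm
      simp [hm]
    · simp
  · intro n hn
    rw [Finset.mem_range] at hn
    rw [ha_sum, Nat.sub_eq_zero_of_le (by omega)]
    simp
end

section
/- For every fixed natural number $j$, $\lim_{n \to \infty} n^{j/2} \begin{bmatrix} n-1 \\ j \end{bmatrix}^{-1} = (2\pi)^{-j/2}\,[j]!$. (This is the Stirling-formula computation leading from equation (5.4) to equation (5.5) of the paper.) -/
/-- `ω n`, the volume of the unit ball in `ℝⁿ`. -/
noncomputable def ballVol (n : ℕ) : ℝ :=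
  Real.pi ^ ((n : ℝ) / 2) / Real.Gamma ((n : ℝ) / 2 + 1)

/-- `[n]! = n! ωₙ`. -/
noncomputable def brackFact (n : ℕ) : ℝ := (Nat.factorial n) * ballVol n

/-- The flag coefficient `[n k] = [n]! / ([k]! [n-k]!)`. -/
noncomputable def flagCoeff (n k : ℕ) : ℝ :=
  brackFact n / (brackFact k * brackFact (n - k))

open Filter Topology

/-- The duplication formula removes the factorial from `[n]!`. -/
lemma brackFact_eq (n : ℕ) :
    brackFact n = (2 * √Real.pi) ^ n / √Real.pi * Real.Gamma (((n : ℝ) + 1) / 2) := by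
  have hpos : 0 < Real.Gamma ((n : ℝ) / 2 + 1) := Real.Gamma_pos_of_pos (by positivity)
  have hdup := Real.Gamma_mul_Gamma_add_half_of_pos (s := ((n : ℝ) + 1) / 2) (by positivity)
  have h₁ : ((n : ℝ) + 1) / 2 + 1 / 2 = n / 2 + 1 := by ring
  have h₂ : 2 * (((n : ℝ) + 1) / 2) = n + 1 := by ring
  have h₃ : (2 : ℝ) ^ (1 - ((n : ℝ) + 1)) = (2 ^ n)⁻¹ := by
    rw [show 1 - ((n : ℝ) + 1) = -(n : ℝ) by ring, Real.rpow_neg (by norm_num), Real.rpow_natCast]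
  have h₄ : Real.pi ^ ((n : ℝ) / 2) = √Real.pi ^ n := by
    rw [Real.sqrt_eq_rpow, ← Real.rpow_natCast, ← Real.rpow_mul Real.pi_pos.le]
    ring_nf
  rw [h₁, h₂, h₃, Real.Gamma_nat_eq_factorial] at hdup
  have hπ : √Real.pi ≠ 0 := (Real.sqrt_pos.2 Real.pi_pos).ne'
  rw [brackFact, ballVol, h₄, mul_div_assoc', div_eq_iff hpos.ne', mul_assoc, hdup, mul_pow]
  field_simp

lemma brackFact_pos (n : ℕ) : 0 < brackFact n := by
  have := Real.Gamma_pos_of_pos (s := ((n : ℝ) + 1) / 2) (by positivity)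
  have := Real.pi_pos
  rw [brackFact_eq]
  positivity

lemma brackFact_add_two (n : ℕ) :
    brackFact (n + 2) = 2 * Real.pi * (n + 1) * brackFact n := by
  have h : (((n + 2 : ℕ) : ℝ) + 1) / 2 = ((n : ℝ) + 1) / 2 + 1 := by push_cast; ring
  rw [brackFact_eq, brackFact_eq, h, Real.Gamma_add_one (by positivity), pow_add,
    show (2 * √Real.pi) ^ 2 = 4 * Real.pi by rw [mul_pow, Real.sq_sqrt Real.pi_pos.le]; norm_num]
  ring

/-- Log-convexity of `n ↦ [n]!`. -/
lemma brackFact_sq_le (n : ℕ) :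
    brackFact (n + 1) ^ 2 ≤ brackFact n * brackFact (n + 2) := by
  have hs : 0 < ((n : ℝ) + 1) / 2 := by positivity
  have ht : 0 < ((n : ℝ) + 1) / 2 + 1 := by positivity
  have hlc := Real.Gamma_mul_add_mul_le_rpow_Gamma_mul_rpow_Gamma hs ht
    (a := 1 / 2) (b := 1 / 2) (by norm_num) (by norm_num) (by norm_num)
  have hm : 1 / 2 * (((n : ℝ) + 1) / 2) + 1 / 2 * (((n : ℝ) + 1) / 2 + 1)
      = (((n + 1 : ℕ) : ℝ) + 1) / 2 := by push_cast; ring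
  have h₂ : ((n : ℝ) + 1) / 2 + 1 = (((n + 2 : ℕ) : ℝ) + 1) / 2 := by push_cast; ring
  have hGs := Real.Gamma_pos_of_pos hs
  have hGt := Real.Gamma_pos_of_pos ht
  have hGm := Real.Gamma_pos_of_pos (s := (((n + 1 : ℕ) : ℝ) + 1) / 2) (by positivity)
  rw [hm, ← Real.sqrt_eq_rpow, ← Real.sqrt_eq_rpow, ← Real.sqrt_mul hGs.le,
    Real.le_sqrt hGm.le (by positivity), h₂] at hlc
  rw [brackFact_eq, brackFact_eq, brackFact_eq]
  calc _ = ((2 * √Real.pi) ^ (n + 1) / √Real.pi) ^ 2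
        * Real.Gamma ((((n + 1 : ℕ) : ℝ) + 1) / 2) ^ 2 := by ring
    _ ≤ _ := mul_le_mul_of_nonneg_left hlc (by positivity)
    _ = _ := by ring

lemma brackFact_succ_sq_le (n : ℕ) :
    brackFact (n + 1) ^ 2 ≤ 2 * Real.pi * (n + 1) * brackFact n ^ 2 := by
  have h := brackFact_sq_le n
  rw [brackFact_add_two] at h
  linarith

lemma le_brackFact_succ_sq (n : ℕ) :
    2 * Real.pi * n * brackFact n ^ 2 ≤ brackFact (n + 1) ^ 2 := by
  cases n with
  | zero => simpa using sq_nonneg (brackFact 1)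
  | succ k =>
    have h := brackFact_succ_sq_le k
    have hk : (0 : ℝ) ≤ 2 * Real.pi * (k + 1) := by have := Real.pi_pos; positivity
    rw [show k + 1 + 1 = k + 2 from rfl, brackFact_add_two]
    push_cast
    nlinarith [mul_le_mul_of_nonneg_left h hk]

lemma tendsto_add_div_add (c d : ℝ) :
    Tendsto (fun m : ℕ => ((m : ℝ) + c) / (m + d)) atTop (𝓝 1) := by
  have hd : Tendsto (fun m : ℕ => (m : ℝ) + d) atTop atTop :=
    tendsto_atTop_add_const_right _ _ tendsto_natCast_atTop_atTop
  have h := (hd.const_div_atTop (c - d)).const_add 1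
  rw [add_zero] at h
  refine h.congr' ?_
  filter_upwards [hd.eventually_gt_atTop 0] with m hm
  field_simp
  ring

lemma tendsto_sqrt_mul_brackFact_div_succ (c : ℝ) :
    Tendsto (fun m : ℕ => √(m + c) * (brackFact m / brackFact (m + 1))) atTop
      (𝓝 (√(2 * Real.pi))⁻¹) := by
  have hπ := Real.pi_pos
  have hlim (d : ℝ) : Tendsto (fun m : ℕ => (2 * Real.pi)⁻¹ * (((m : ℝ) + c) / (m + d))) atTop
      (𝓝 (2 * Real.pi)⁻¹) := by
    simpa using (tendsto_add_div_add c d).const_mul (2 * Real.pi)⁻¹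
  have hc : ∀ᶠ m : ℕ in atTop, 0 < (m : ℝ) + c :=
    (tendsto_atTop_add_const_right _ c tendsto_natCast_atTop_atTop).eventually_gt_atTop 0
  have hsq : Tendsto (fun m : ℕ => ((m : ℝ) + c) * (brackFact m / brackFact (m + 1)) ^ 2) atTop
      (𝓝 (2 * Real.pi)⁻¹) := by
    refine tendsto_of_tendsto_of_tendsto_of_le_of_le' (hlim 1) (hlim 0) ?_ ?_
    · filter_upwards [hc] with m hm
      have h₀ := brackFact_pos m
      have h₁ := brackFact_pos (m + 1)
      have h : (2 * Real.pi * ((m : ℝ) + 1))⁻¹ ≤ (brackFact m / brackFact (m + 1)) ^ 2 := by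
        rw [div_pow, inv_eq_one_div, div_le_div_iff₀ (by positivity) (by positivity)]
        linarith [brackFact_succ_sq_le m]
      calc _ = ((m : ℝ) + c) * (2 * Real.pi * ((m : ℝ) + 1))⁻¹ := by field_simp
        _ ≤ _ := mul_le_mul_of_nonneg_left h hm.le
    · filter_upwards [hc, eventually_gt_atTop 0] with m hm hm₀
      have h₀ := brackFact_pos m
      have h₁ := brackFact_pos (m + 1)
      have hm' : (0 : ℝ) < m := by exact_mod_cast hm₀
      have h : (brackFact m / brackFact (m + 1)) ^ 2 ≤ (2 * Real.pi * (m : ℝ))⁻¹ := by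
        rw [div_pow, inv_eq_one_div, div_le_div_iff₀ (by positivity) (by positivity)]
        linarith [le_brackFact_succ_sq m]
      calc _ ≤ ((m : ℝ) + c) * (2 * Real.pi * (m : ℝ))⁻¹ := mul_le_mul_of_nonneg_left h hm.le
        _ = _ := by rw [mul_inv (2 * Real.pi), add_zero]; ring
  have h := hsq.sqrt
  rw [Real.sqrt_inv] at h
  refine h.congr' ?_
  filter_upwards [hc] with m hm
  rw [Real.sqrt_mul hm.le,
    Real.sqrt_sq (div_pos (brackFact_pos m) (brackFact_pos (m + 1))).le]

lemma tendsto_sqrt_pow_mul_brackFact_div (j : ℕ) (c : ℝ) :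
    Tendsto (fun m : ℕ => √(m + c) ^ j * (brackFact m / brackFact (m + j))) atTop
      (𝓝 ((√(2 * Real.pi))⁻¹ ^ j)) := by
  induction j generalizing c with
  | zero => simp [div_self (brackFact_pos _).ne']
  | succ j ih =>
    have h := ((ih (c - 1)).comp (tendsto_add_atTop_nat 1)).mul
      (tendsto_sqrt_mul_brackFact_div_succ c)
    rw [← pow_succ] at h
    refine h.congr fun m => ?_
    have h₁ := (brackFact_pos (m + 1)).ne'
    have h₂ := (brackFact_pos (m + (j + 1))).ne'
    rw [Function.comp_apply, show m + 1 + j = m + (j + 1) by ring,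
      show (((m + 1 : ℕ) : ℝ) + (c - 1)) = m + c by push_cast; ring, pow_succ]
    field_simp

/-- The Stirling-formula limit leading from (5.4) to (5.5):
`n^{j/2} [n-1 j]⁻¹ → (2π)^{-j/2} [j]!` as `n → ∞`. -/
theorem flag_coeff_stirling_limit (j : ℕ) :
    Filter.Tendsto (fun n : ℕ => (n : ℝ) ^ ((j : ℝ) / 2) * (flagCoeff (n - 1) j)⁻¹)
      Filter.atTop (nhds ((2 * Real.pi) ^ (-(j : ℝ) / 2) * brackFact j)) := by
  have hrpow {x : ℝ} (hx : 0 ≤ x) : x ^ ((j : ℝ) / 2) = √x ^ j := by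
    rw [Real.sqrt_eq_rpow, ← Real.rpow_natCast, ← Real.rpow_mul hx]
    ring_nf
  have hπ : (0 : ℝ) ≤ 2 * Real.pi := by have := Real.pi_pos; positivity
  rw [neg_div, Real.rpow_neg hπ, hrpow hπ, ← inv_pow, ← tendsto_add_atTop_iff_nat (j + 1)]
  refine ((tendsto_sqrt_pow_mul_brackFact_div j (j + 1)).mul_const (brackFact j)).congr fun m => ?_
  rw [hrpow (Nat.cast_nonneg _), flagCoeff, show m + (j + 1) - 1 = m + j by omega,
    Nat.add_sub_cancel, inv_div]
  push_cast
  ring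
end

section
/- Fix natural numbers $k \ge 1$ and $a \ge 0$, and a real number $r \ge 0$. Then $\lim_{n \to \infty} \frac{s_{n-k}}{s_n\, n^{(n-1)/2}} \binom{n-k-1}{a} (n - r)^{(n-k-2a-1)/2} = \frac{(2\pi)^{-k/2}}{a!}\, e^{-r/2}$, where the limit is over natural numbers $n$ large enough that $n > k$ and $n > r$. (This is the limit computation in the proof of Lemma 7.1 of the paper, with $r = \|t\|^2$ and $a = i+j-k-l$, which produces the Gaussian density in the limit.) -/
/-- `sₙ = 2 π^(n/2) / Γ(n/2)`, the surface area of the unit sphere in `ℝⁿ`. -/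
noncomputable def sphereSurf (n : ℕ) : ℝ :=
  2 * Real.pi ^ ((n : ℝ) / 2) / Real.Gamma ((n : ℝ) / 2)

open Filter Topology

theorem Real.Gamma_add_half_sq_le {x : ℝ} (hx : 0 < x) :
    Real.Gamma (x + 1 / 2) ^ 2 ≤ Real.Gamma x ^ 2 * x := by
  have hG := Real.Gamma_pos_of_pos hx
  have h := Real.Gamma_mul_add_mul_le_rpow_Gamma_mul_rpow_Gamma hx (by linarith : 0 < x + 1)
    (by norm_num : (0 : ℝ) < 1 / 2) (by norm_num : (0 : ℝ) < 1 / 2) (by norm_num)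
  rw [← Real.mul_rpow hG.le (Real.Gamma_pos_of_pos (by linarith)).le, ← Real.sqrt_eq_rpow,
    Real.Gamma_add_one hx.ne', show 1 / 2 * x + 1 / 2 * (x + 1) = x + 1 / 2 by ring] at h
  calc Real.Gamma (x + 1 / 2) ^ 2 ≤ √(Real.Gamma x * (x * Real.Gamma x)) ^ 2 :=
        pow_le_pow_left₀ (Real.Gamma_pos_of_pos (by linarith)).le h 2
    _ = Real.Gamma x ^ 2 * x := by
        rw [Real.sq_sqrt (by positivity)]
        ring

theorem Real.tendsto_Gamma_add_half_div_atTop :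
    Tendsto (fun x : ℝ => Real.Gamma (x + 1 / 2) / (Real.Gamma x * x ^ (1 / 2 : ℝ)))
      atTop (𝓝 1) := by
  have hsq : Tendsto (fun x : ℝ => Real.Gamma (x + 1 / 2) ^ 2 / (Real.Gamma x ^ 2 * x))
      atTop (𝓝 1) := by
    have hlow : Tendsto (fun x : ℝ => 1 - 1 / 2 / (x + 1 / 2)) atTop (𝓝 1) := by
      simpa using ((tendsto_const_nhds (x := (1 / 2 : ℝ))).div_atTop
        (tendsto_atTop_add_const_right atTop (1 / 2 : ℝ) tendsto_id)).const_sub 1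
    refine tendsto_of_tendsto_of_tendsto_of_le_of_le' hlow tendsto_const_nhds ?_ ?_
    · filter_upwards [eventually_gt_atTop 0] with x hx
      have hG := Real.Gamma_pos_of_pos hx
      have h := Real.Gamma_add_half_sq_le (by linarith : 0 < x + 1 / 2)
      rw [show x + 1 / 2 + 1 / 2 = x + 1 by ring, Real.Gamma_add_one hx.ne'] at h
      have h1 : 1 - 1 / 2 / (x + 1 / 2) = x / (x + 1 / 2) := by field_simp; ring
      rw [h1, div_le_div_iff₀ (by positivity) (by positivity)]
      linarith
    · filter_upwards [eventually_gt_atTop 0] with x hx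
      have hG := Real.Gamma_pos_of_pos hx
      rw [div_le_one (by positivity)]
      exact Real.Gamma_add_half_sq_le hx
  have hroot := hsq.sqrt
  rw [Real.sqrt_one] at hroot
  refine hroot.congr' ?_
  filter_upwards [eventually_gt_atTop 0] with x hx
  have hG := Real.Gamma_pos_of_pos hx
  rw [Real.sqrt_div (by positivity), Real.sqrt_mul (by positivity), Real.sqrt_sq hG.le,
    Real.sqrt_sq (Real.Gamma_pos_of_pos (by linarith)).le, Real.sqrt_eq_rpow]

theorem tendsto_add_const_div_add_const_atTop (b c : ℝ) :
    Tendsto (fun x : ℝ => (x + b) / (x + c)) atTop (𝓝 1) := by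
  have h : Tendsto (fun x : ℝ => 1 + (b - c) / (x + c)) atTop (𝓝 1) := by
    simpa using ((tendsto_const_nhds (x := b - c)).div_atTop
      (tendsto_atTop_add_const_right atTop c tendsto_id)).const_add 1
  refine h.congr' ?_
  filter_upwards [eventually_gt_atTop (-c)] with x hx
  have : x + c ≠ 0 := by linarith
  field_simp
  ring

theorem Real.tendsto_Gamma_add_nat_div_two_atTop (k : ℕ) :
    Tendsto (fun x : ℝ => Real.Gamma (x + k / 2) / (Real.Gamma x * x ^ ((k : ℝ) / 2)))
      atTop (𝓝 1) := by
  induction k with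
  | zero =>
    refine tendsto_const_nhds.congr' ?_
    filter_upwards [eventually_gt_atTop 0] with x hx
    simp [(Real.Gamma_pos_of_pos hx).ne']
  | succ k ih =>
    have hstep := Real.tendsto_Gamma_add_half_div_atTop.comp
      (tendsto_atTop_add_const_right atTop ((k : ℝ) / 2) tendsto_id)
    have hpow := (tendsto_add_const_div_add_const_atTop ((k : ℝ) / 2) 0).rpow_const
      (p := 1 / 2) (Or.inl one_ne_zero)
    have h := (ih.mul hstep).mul hpow
    rw [Real.one_rpow, mul_one, mul_one] at h
    refine h.congr' ?_
    filter_upwards [eventually_gt_atTop 0] with x hx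
    have hG := (Real.Gamma_pos_of_pos hx).ne'
    have hxk : 0 < x + (k : ℝ) / 2 := by positivity
    have hGk := (Real.Gamma_pos_of_pos hxk).ne'
    have hp := (Real.rpow_pos_of_pos hxk (1 / 2)).ne'
    have hq := (Real.rpow_pos_of_pos hx (1 / 2)).ne'
    have hs := (Real.rpow_pos_of_pos hx ((k : ℝ) / 2)).ne'
    simp only [Function.comp_apply, id_eq, add_zero]
    rw [Real.div_rpow hxk.le hx.le]
    push_cast
    rw [add_div (k : ℝ) 1 2, Real.rpow_add hx, ← add_assoc]
    field_simp

theorem Real.tendsto_one_sub_div_rpow_half_sub (r c : ℝ) :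
    Tendsto (fun x : ℝ => (1 - r / x) ^ ((x - c) / 2)) atTop (𝓝 (Real.exp (-r / 2))) := by
  have hbase := Real.tendsto_one_add_div_rpow_exp (-r)
  have hexp : Tendsto (fun x : ℝ => (x + -c) / (x + 0) / 2) atTop (𝓝 (1 / 2)) :=
    (tendsto_add_const_div_add_const_atTop (-c) 0).div_const 2
  have h := hbase.rpow hexp (Or.inl (Real.exp_pos _).ne')
  rw [← Real.exp_mul, show -r * (1 / 2) = -r / 2 by ring] at h
  refine h.congr' ?_
  filter_upwards [eventually_gt_atTop 0, eventually_gt_atTop r] with x hx hxr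
  have hpos : 0 ≤ 1 - r / x := by
    rw [sub_nonneg, div_le_one hx]
    exact hxr.le
  rw [show 1 + -r / x = 1 - r / x by ring, ← Real.rpow_mul hpos]
  congr 1
  field_simp
  ring

theorem tendsto_choose_div_add_pow (a : ℕ) (c : ℝ) :
    Tendsto (fun m : ℕ => (m.choose a : ℝ) / ((m : ℝ) + c) ^ a) atTop
      (𝓝 (1 / (a.factorial : ℝ))) := by
  have ha : (a.factorial : ℝ) ≠ 0 := by exact_mod_cast a.factorial_ne_zero
  have hchoose : Tendsto (fun m : ℕ => (m.choose a : ℝ) / ((m : ℝ) ^ a / a.factorial))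
      atTop (𝓝 1) := by
    refine (Asymptotics.isEquivalent_iff_tendsto_one ?_).1 (isEquivalent_choose a)
    filter_upwards [eventually_gt_atTop 0] with m hm
    have : (0 : ℝ) < m := by exact_mod_cast hm
    positivity
  have hratio := ((tendsto_add_const_div_add_const_atTop 0 c).comp
    (tendsto_natCast_atTop_atTop (R := ℝ))).pow a
  have h := (hchoose.mul hratio).div_const (a.factorial : ℝ)
  rw [one_pow, mul_one] at h
  refine h.congr' ?_
  filter_upwards [eventually_gt_atTop 0] with m hm
  have : (m : ℝ) ≠ 0 := by exact_mod_cast hm.ne'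
  simp only [Function.comp_apply, add_zero, div_pow]
  field_simp

theorem sphereSurf_div_sphereSurf_add {m : ℕ} (hm : 0 < m) (k : ℕ) :
    sphereSurf m / sphereSurf (m + k) =
      Real.pi ^ (-(k : ℝ) / 2) *
        (Real.Gamma ((m : ℝ) / 2 + k / 2) / Real.Gamma ((m : ℝ) / 2)) := by
  have hm' : (0 : ℝ) < m := by exact_mod_cast hm
  have hG := (Real.Gamma_pos_of_pos (by positivity : 0 < (m : ℝ) / 2)).ne'
  have hGk := (Real.Gamma_pos_of_pos (by positivity : 0 < (m : ℝ) / 2 + k / 2)).ne'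
  have hp := (Real.rpow_pos_of_pos Real.pi_pos ((m : ℝ) / 2)).ne'
  have hq := (Real.rpow_pos_of_pos Real.pi_pos ((k : ℝ) / 2)).ne'
  unfold sphereSurf
  push_cast
  rw [add_div, Real.rpow_add Real.pi_pos, neg_div, Real.rpow_neg Real.pi_pos.le]
  field_simp

/-- The limit computation in the proof of Lemma 7.1, producing the
Gaussian density in the limit:
`s_{n-k} / (s_n n^{(n-1)/2}) · C(n-k-1, a) · (n-r)^{(n-k-2a-1)/2} → (2π)^{-k/2} e^{-r/2} / a!`. -/
theorem gaussian_density_limit (k a : ℕ) (hk : 1 ≤ k) (r : ℝ) (hr : 0 ≤ r) :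
    Filter.Tendsto (fun n : ℕ =>
        sphereSurf (n - k) / (sphereSurf n * (n : ℝ) ^ (((n : ℝ) - 1) / 2)) *
          (Nat.choose (n - k - 1) a) *
          ((n : ℝ) - r) ^ (((n : ℝ) - (k : ℝ) - 2 * (a : ℝ) - 1) / 2))
      Filter.atTop
      (nhds ((2 * Real.pi) ^ (-(k : ℝ) / 2) / (Nat.factorial a) * Real.exp (-r / 2))) := by
  rw [← tendsto_add_atTop_iff_nat (k + 1)]
  have hcast := tendsto_natCast_atTop_atTop (R := ℝ)
  have hGamma := (Real.tendsto_Gamma_add_nat_div_two_atTop k).comp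
    ((tendsto_atTop_add_const_right atTop (1 : ℝ) hcast).atTop_div_const two_pos)
  have hratio := ((tendsto_add_const_div_add_const_atTop 1 ((k : ℝ) + 1)).comp hcast).rpow_const
    (p := (k : ℝ) / 2) (Or.inl one_ne_zero)
  have hexp := (Real.tendsto_one_sub_div_rpow_half_sub r ((k : ℝ) + 2 * a + 1)).comp
    (tendsto_atTop_add_const_right atTop ((k : ℝ) + 1) hcast)
  have h := (((hGamma.mul hratio).const_mul ((2 * Real.pi) ^ (-(k : ℝ) / 2))).mul
    (tendsto_choose_div_add_pow a ((k : ℝ) + 1))).mul hexp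
  rw [Real.one_rpow, mul_one, mul_one, mul_one_div] at h
  refine h.congr' ?_
  filter_upwards [hcast.eventually_gt_atTop r] with m hm
  have hn : (0 : ℝ) < (m : ℝ) + (k + 1) := by positivity
  have hsurf := sphereSurf_div_sphereSurf_add (Nat.add_one_pos m) k
  have hidx : m + (k + 1) = m + 1 + k := by ring
  simp only [Function.comp_apply]
  rw [show m + (k + 1) - k = m + 1 by omega, Nat.add_sub_cancel, ← div_div (sphereSurf (m + 1)),
    show sphereSurf (m + (k + 1)) = sphereSurf (m + 1 + k) by rw [hidx], hsurf]
  push_cast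
  set n : ℝ := (m : ℝ) + (k + 1) with hndef
  have hnr : 0 ≤ 1 - r / n := by
    rw [sub_nonneg, div_le_one hn]
    linarith
  have hbase : n - r = n * (1 - r / n) := by field_simp
  have hexponent : (n - 1) / 2 =
      (n - (k : ℝ) - 2 * (a : ℝ) - 1) / 2 + (k : ℝ) / 2 + (a : ℝ) := by ring
  have hx : (0 : ℝ) < (m : ℝ) + 1 := by positivity
  have hG := (Real.Gamma_pos_of_pos (by positivity : 0 < ((m : ℝ) + 1) / 2)).ne'
  have hxk := (Real.rpow_pos_of_pos hx ((k : ℝ) / 2)).ne'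
  have hnk := (Real.rpow_pos_of_pos hn ((k : ℝ) / 2)).ne'
  have hne := (Real.rpow_pos_of_pos hn ((n - (k : ℝ) - 2 * (a : ℝ) - 1) / 2)).ne'
  have htwo := (Real.rpow_pos_of_pos two_pos ((k : ℝ) / 2)).ne'
  have hpi := (Real.rpow_pos_of_pos Real.pi_pos ((k : ℝ) / 2)).ne'
  rw [hbase, Real.mul_rpow hn.le hnr, hexponent, Real.rpow_add hn, Real.rpow_add hn,
    Real.rpow_natCast, Real.div_rpow hx.le hn.le, Real.div_rpow hx.le two_pos.le,
    Real.mul_rpow two_pos.le Real.pi_pos.le, neg_div, Real.rpow_neg two_pos.le,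
    show n - ((k : ℝ) + 2 * a + 1) = n - k - 2 * a - 1 by ring]
  field_simp
end
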